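/- Hamiltonian (Hamilton–De Donder–Weyl) formulation of minimal surfaces: Let y : (Fin 2 → ℝ) → ℝ and p = (p¹, p²) : (Fin 2 → ℝ) → ℝ² be smooth with p¹(x)² + p²(x)² < 1 for all x. Then the pair (y, p) satisfies the Hamilton–De Donder–Weyl system ∂y/∂x^ν(x) = p^ν(x) / (1 − p¹(x)² − p²(x)²)^{1/2} for ν = 1, 2 and ∂p¹/∂x^1(x) + ∂p²/∂x^2(x) = 0, if and only if p^ν(x) = y_ν(x) / W_y(x) for ν = 1, 2 at every x and y satisfies the minimal surface equation at every point. -/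

import Mathlib

open MeasureTheory

/-- Partial derivative of a real-valued function on `Fin 2 → ℝ` in the `i`-th
coordinate direction. -/
noncomputable def pd (f : (Fin 2 → ℝ) → ℝ) (i : Fin 2) (x : Fin 2 → ℝ) : ℝ :=
  fderiv ℝ f x (Pi.single i 1)

/-- Second partial derivative `∂²f/∂x^i∂x^j`. -/
noncomputable def pd2 (f : (Fin 2 → ℝ) → ℝ) (i j : Fin 2) (x : Fin 2 → ℝ) : ℝ :=
  pd (fun x' => pd f j x') i x

/-- The area density `W_φ = (1 + φ₁² + φ₂²)^{1/2}`. -/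
noncomputable def Wd (f : (Fin 2 → ℝ) → ℝ) (x : Fin 2 → ℝ) : ℝ :=
  Real.sqrt (1 + pd f 0 x ^ 2 + pd f 1 x ^ 2)

/-- The gradient map `a ↦ a / √(1 + |a|²)` onto the unit disc and the map
`p ↦ p / √(1 - |p|²)` are inverse to each other. -/
lemma div_sqrt_one_sub_iff {a b P Q : ℝ} (h : P ^ 2 + Q ^ 2 < 1) :
    (a = P / √(1 - P ^ 2 - Q ^ 2) ∧ b = Q / √(1 - P ^ 2 - Q ^ 2)) ↔
      (P = a / √(1 + a ^ 2 + b ^ 2) ∧ Q = b / √(1 + a ^ 2 + b ^ 2)) := by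
  constructor
  · have hs : 0 < √(1 - P ^ 2 - Q ^ 2) := Real.sqrt_pos.2 (by linarith)
    have hq : √(1 - P ^ 2 - Q ^ 2) ^ 2 = 1 - P ^ 2 - Q ^ 2 := Real.sq_sqrt (by linarith)
    generalize √(1 - P ^ 2 - Q ^ 2) = s at hs hq
    rintro ⟨rfl, rfl⟩
    have hw : √(1 + (P / s) ^ 2 + (Q / s) ^ 2) = 1 / s := by
      rw [Real.sqrt_eq_iff_mul_self_eq (by positivity) (by positivity)]
      field_simp
      linarith
    rw [hw]
    constructor <;> field_simp
  · have hs : 0 < √(1 + a ^ 2 + b ^ 2) := Real.sqrt_pos.2 (by positivity)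
    have hq : √(1 + a ^ 2 + b ^ 2) ^ 2 = 1 + a ^ 2 + b ^ 2 := Real.sq_sqrt (by positivity)
    generalize √(1 + a ^ 2 + b ^ 2) = s at hs hq
    rintro ⟨rfl, rfl⟩
    have hw : √(1 - (a / s) ^ 2 - (b / s) ^ 2) = 1 / s := by
      rw [Real.sqrt_eq_iff_mul_self_eq (by linarith) (by positivity)]
      field_simp
      linarith
    rw [hw]
    constructor <;> field_simp

lemma hasDerivAt_pd {f : (Fin 2 → ℝ) → ℝ} {x : Fin 2 → ℝ} (hf : DifferentiableAt ℝ f x)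
    (i : Fin 2) :
    HasDerivAt (fun t : ℝ => f (x + t • Pi.single i 1)) (pd f i x) 0 :=
  hf.hasFDerivAt.hasLineDerivAt _

lemma pd_div_sqrt {f g h : (Fin 2 → ℝ) → ℝ} {x : Fin 2 → ℝ} (hf : DifferentiableAt ℝ f x)
    (hg : DifferentiableAt ℝ g x) (hh : DifferentiableAt ℝ h x) (i : Fin 2) :
    pd (fun z => f z / √(1 + g z ^ 2 + h z ^ 2)) i x =
      (pd f i x * (1 + g x ^ 2 + h x ^ 2) - f x * (g x * pd g i x + h x * pd h i x)) /
        √(1 + g x ^ 2 + h x ^ 2) ^ 3 := by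
  have hpos : 0 < 1 + g x ^ 2 + h x ^ 2 := by positivity
  have hs : 0 < √(1 + g x ^ 2 + h x ^ 2) := Real.sqrt_pos.2 hpos
  have hdiff : DifferentiableAt ℝ (fun z => f z / √(1 + g z ^ 2 + h z ^ 2)) x := by
    simp only [div_eq_mul_inv]
    exact hf.mul (DifferentiableAt.inv (h := fun z => √(1 + g z ^ 2 + h z ^ 2))
      (DifferentiableAt.sqrt (by fun_prop) hpos.ne') hs.ne')
  have hsq : √(1 + g x ^ 2 + h x ^ 2) ^ 2 = 1 + g x ^ 2 + h x ^ 2 := Real.sq_sqrt hpos.le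
  have key := (hasDerivAt_pd hf i).div (((((hasDerivAt_pd hg i).pow 2).const_add 1).add
    ((hasDerivAt_pd hh i).pow 2)).sqrt (by simpa using hpos.ne')) (by simpa using hs.ne')
  rw [(hasDerivAt_pd hdiff i).unique key]
  simp only [zero_smul, add_zero, Pi.add_apply, Pi.pow_apply]
  generalize √(1 + g x ^ 2 + h x ^ 2) = s at hs hsq
  rw [← hsq]
  field_simp
  push_cast
  ring

lemma differentiable_pd {y : (Fin 2 → ℝ) → ℝ} (hy : ContDiff ℝ 2 y) (i : Fin 2) :
    Differentiable ℝ (pd y i) :=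
  ((hy.fderiv_right (m := 1) (by norm_num)).differentiable (by norm_num)).clm_apply
    (differentiable_const _)

lemma pd2_comm {y : (Fin 2 → ℝ) → ℝ} (hy : ContDiff ℝ 2 y) (i j : Fin 2) (x : Fin 2 → ℝ) :
    pd2 y i j x = pd2 y j i x := by
  have hd : DifferentiableAt ℝ (fderiv ℝ y) x :=
    (hy.fderiv_right (m := 1) (by norm_num)).differentiable (by norm_num) x
  have hpd (k l : Fin 2) :
      pd2 y k l x = fderiv ℝ (fderiv ℝ y) x (Pi.single k 1) (Pi.single l 1) := by
    unfold pd2 pd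
    rw [fderiv_clm_apply hd (differentiableAt_const _)]
    simp
  rw [hpd, hpd]
  exact (hy.contDiffAt.isSymmSndFDerivAt (by simp)) _ _

/-- The divergence of the normalized gradient is the minimal surface operator over `W ^ 3`. -/
lemma pd_div_Wd_add {y : (Fin 2 → ℝ) → ℝ} (hy : ContDiff ℝ 2 y) (x : Fin 2 → ℝ) :
    pd (fun z => pd y 0 z / Wd y z) 0 x + pd (fun z => pd y 1 z / Wd y z) 1 x =
      ((1 + pd y 0 x ^ 2) * pd2 y 1 1 x + (1 + pd y 1 x ^ 2) * pd2 y 0 0 x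
        - 2 * pd y 0 x * pd y 1 x * pd2 y 0 1 x) / Wd y x ^ 3 := by
  have h0 := differentiable_pd hy 0 x
  have h1 := differentiable_pd hy 1 x
  have hc : pd (pd y 0) 1 x = pd (pd y 1) 0 x := pd2_comm hy 1 0 x
  unfold Wd pd2
  rw [pd_div_sqrt h0 h0 h1, pd_div_sqrt h1 h0 h1, hc]
  ring

/-- Hamiltonian (Hamilton–De Donder–Weyl) formulation of minimal surfaces. -/
theorem minimal_surface_HDW_iff
    (y : (Fin 2 → ℝ) → ℝ) (hy : ContDiff ℝ (⊤ : ℕ∞) y)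
    (p : (Fin 2 → ℝ) → (Fin 2 → ℝ)) (hp : ContDiff ℝ (⊤ : ℕ∞) p)
    (hdisc : ∀ x : Fin 2 → ℝ, p x 0 ^ 2 + p x 1 ^ 2 < 1) :
    ((∀ (x : Fin 2 → ℝ) (ν : Fin 2),
        pd y ν x = p x ν / Real.sqrt (1 - p x 0 ^ 2 - p x 1 ^ 2)) ∧
      (∀ x : Fin 2 → ℝ,
        pd (fun x' => p x' 0) 0 x + pd (fun x' => p x' 1) 1 x = 0)) ↔
    ((∀ (x : Fin 2 → ℝ) (ν : Fin 2), p x ν = pd y ν x / Wd y x) ∧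
      (∀ x : Fin 2 → ℝ,
        (1 + pd y 0 x ^ 2) * pd2 y 1 1 x + (1 + pd y 1 x ^ 2) * pd2 y 0 0 x
          - 2 * pd y 0 x * pd y 1 x * pd2 y 0 1 x = 0)) := by
  have hy2 : ContDiff ℝ 2 y := contDiff_infty.1 hy 2
  have hleg : (∀ (x : Fin 2 → ℝ) (ν : Fin 2),
      pd y ν x = p x ν / Real.sqrt (1 - p x 0 ^ 2 - p x 1 ^ 2)) ↔
      ∀ (x : Fin 2 → ℝ) (ν : Fin 2), p x ν = pd y ν x / Wd y x :=
    forall_congr' fun x => by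
      simpa only [Fin.forall_fin_two, Wd] using div_sqrt_one_sub_iff (hdisc x)
  rw [hleg]
  refine and_congr_right fun hpy => forall_congr' fun x => ?_
  have hW : Wd y x ≠ 0 := (Real.sqrt_pos.2 (by positivity)).ne'
  simp only [hpy]
  rw [pd_div_Wd_add hy2, div_eq_zero_iff, or_iff_left (pow_ne_zero 3 hW)]
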